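/- Let a > 0. There is no C² function g : (e^{-a}, 1) → (0,1) satisfying the ODE g''(r) + g'(r)/r − g(r)/r² − (1 + ln g(r))/(g(r)·ln g(r)) · ( g'(r)² − g(r)²/r² ) = 0 on (e^{-a}, 1), and satisfying either (g'(r) > 0 for all r, lim_{r→e^{-a}⁺} g(r) = 0, lim_{r→1⁻} g(r) = 1) or (g'(r) < 0 for all r, lim_{r→e^{-a}⁺} g(r) = 1, lim_{r→1⁻} g(r) = 0). -/

import Mathlib

open Real Set Filter Topology

/-- The first integral of the rotationally symmetric harmonic map equation into the hyperbolic
punctured disc. -/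
theorem hasDerivAt_firstIntegral {g : ℝ → ℝ} {r g₁ g₂ : ℝ} (hr : 0 < r) (hg : g r ∈ Ioo (0 : ℝ) 1)
    (h₁ : HasDerivAt g g₁ r) (h_deriv : deriv g r = g₁) (h₂ : HasDerivAt (deriv g) g₂ r)
    (ode : g₂ + g₁ / r - g r / r ^ 2 -
      (1 + Real.log (g r)) / (g r * Real.log (g r)) * (g₁ ^ 2 - (g r) ^ 2 / r ^ 2) = 0) :
    HasDerivAt (fun x => ((x * deriv g x / g x) ^ 2 - 1) / (Real.log (g x)) ^ 2) 0 r := by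
  have hg0 : g r ≠ 0 := hg.1.ne'
  have hl : Real.log (g r) ≠ 0 := (Real.log_neg hg.1 hg.2).ne
  have h := (((((hasDerivAt_id r).mul h₂).div h₁ hg0).pow 2).sub_const 1).div
    ((h₁.log hg0).pow 2) (pow_ne_zero 2 hl)
  refine h.congr_deriv ?_
  have hg₂ : g₂ = -(g₁ / r) + g r / r ^ 2 +
      (1 + Real.log (g r)) / (g r * Real.log (g r)) * (g₁ ^ 2 - (g r) ^ 2 / r ^ 2) := by
    linarith
  simp only [Pi.mul_apply, Pi.div_apply, Pi.pow_apply, id, h_deriv, hg₂]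
  generalize Real.log (g r) = l at hl ⊢
  generalize g r = y at hg0 ⊢
  push_cast
  field_simp
  ring

/-- A positive function with values below one whose logarithmic derivative grows at most linearly in
its logarithm stays away from zero on bounded intervals. -/
theorem exists_pos_le_of_abs_deriv_le {g : ℝ → ℝ} {α β K M : ℝ} (hαβ : α < β) (hK : 0 < K)
    (hM : 0 ≤ M) (hd : ∀ r ∈ Ioo α β, DifferentiableAt ℝ g r)
    (hg : ∀ r ∈ Ioo α β, g r ∈ Ioo (0 : ℝ) 1)
    (hb : ∀ r ∈ Ioo α β, |deriv g r / g r| ≤ M * (1 - K * Real.log (g r))) :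
    ∃ δ > 0, ∀ r ∈ Ioo α β, δ ≤ g r := by
  have hpos : ∀ r ∈ Ioo α β, 0 < 1 - K * Real.log (g r) := fun r hr => by
    have := mul_pos hK (neg_pos.2 (Real.log_neg (hg r hr).1 (hg r hr).2))
    linarith
  obtain ⟨c, hc⟩ := nonempty_Ioo.2 hαβ
  have hF : ∀ r ∈ Ioo α β, HasDerivWithinAt (fun x => Real.log (1 - K * Real.log (g x)))
      (-(K * (deriv g r / g r)) / (1 - K * Real.log (g r))) (Ioo α β) r := fun r hr =>
    (((((hd r hr).hasDerivAt.log (hg r hr).1.ne').const_mul K).const_sub 1).log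
      (hpos r hr).ne').hasDerivWithinAt
  have hF' : ∀ r ∈ Ioo α β,
      ‖-(K * (deriv g r / g r)) / (1 - K * Real.log (g r))‖ ≤ K * M := fun r hr => by
    rw [Real.norm_eq_abs, abs_div, abs_neg, abs_mul, abs_of_pos hK, abs_of_pos (hpos r hr),
      div_le_iff₀ (hpos r hr), mul_assoc]
    exact mul_le_mul_of_nonneg_left (hb r hr) hK.le
  set C := Real.log (1 - K * Real.log (g c)) + K * M * (β - α) with hC
  refine ⟨Real.exp (-(Real.exp C / K)), Real.exp_pos _, fun r hr => ?_⟩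
  have h := (convex_Ioo α β).norm_image_sub_le_of_norm_hasDerivWithin_le hF hF' hc hr
  have hrc : ‖r - c‖ ≤ β - α := by
    rw [Real.norm_eq_abs, abs_le]
    constructor <;> linarith [hc.1, hc.2, hr.1, hr.2]
  have h_mul := mul_le_mul_of_nonneg_left hrc (mul_nonneg hK.le hM)
  have hle : Real.log (1 - K * Real.log (g r)) ≤ C := by
    have := (le_abs_self _).trans (h.trans h_mul)
    linarith
  rw [← Real.le_log_iff_exp_le (hg r hr).1, neg_le, le_div_iff₀ hK]
  have := (Real.log_le_iff_le_exp (hpos r hr)).1 hle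
  linarith

/-- A radial harmonic map profile on an interval bounded away from the origin stays away from
zero. -/
theorem exists_pos_le_of_harmonic_profile {g : ℝ → ℝ} {α β : ℝ} (hα : 0 < α) (hαβ : α < β)
    (hC : ContDiffOn ℝ 2 g (Ioo α β)) (hg : ∀ r ∈ Ioo α β, g r ∈ Ioo (0 : ℝ) 1)
    (ode : ∀ r ∈ Ioo α β,
      deriv (deriv g) r + deriv g r / r - g r / r ^ 2 -
        (1 + Real.log (g r)) / (g r * Real.log (g r)) *
          ((deriv g r) ^ 2 - (g r) ^ 2 / r ^ 2) = 0) :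
    ∃ δ > 0, ∀ r ∈ Ioo α β, δ ≤ g r := by
  have hd : ∀ r ∈ Ioo α β, DifferentiableAt ℝ g r := fun r hr =>
    (hC.differentiableOn (by norm_num)).differentiableAt (isOpen_Ioo.mem_nhds hr)
  have hC' : ContDiffOn ℝ 1 (deriv g) (Ioo α β) :=
    hC.deriv_of_isOpen isOpen_Ioo (by norm_num)
  have hd' : ∀ r ∈ Ioo α β, DifferentiableAt ℝ (deriv g) r := fun r hr =>
    (hC'.differentiableOn (by norm_num)).differentiableAt (isOpen_Ioo.mem_nhds hr)
  have hE : ∀ r ∈ Ioo α β,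
      HasDerivAt (fun x => ((x * deriv g x / g x) ^ 2 - 1) / (Real.log (g x)) ^ 2) 0 r :=
    fun r hr => hasDerivAt_firstIntegral (hα.trans hr.1) (hg r hr) (hd r hr).hasDerivAt rfl
      (hd' r hr).hasDerivAt (ode r hr)
  obtain ⟨c, hc⟩ := isOpen_Ioo.exists_is_const_of_deriv_eq_zero isPreconnected_Ioo
    (fun r hr => (hE r hr).differentiableAt.differentiableWithinAt) (fun r hr => (hE r hr).deriv)
  have hK : 0 < |c| + 1 := by positivity
  refine exists_pos_le_of_abs_deriv_le hαβ hK (inv_nonneg.2 hα.le) hd hg fun r hr => ?_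
  have hr0 : 0 < r := hα.trans hr.1
  have hl := Real.log_neg (hg r hr).1 (hg r hr).2
  have h := hc r hr
  rw [div_eq_iff (pow_ne_zero 2 hl.ne), mul_div_assoc] at h
  generalize deriv g r / g r = q at *
  generalize Real.log (g r) = l at *
  have hKl : 0 < (|c| + 1) * -l := mul_pos hK (neg_pos.2 hl)
  have hsq : (r * q) ^ 2 ≤ (1 - (|c| + 1) * l) ^ 2 := by
    have h₁ : c * l ^ 2 ≤ |c| * l ^ 2 := mul_le_mul_of_nonneg_right (le_abs_self c) (sq_nonneg l)
    have h₂ : 0 ≤ (|c| ^ 2 + |c| + 1) * l ^ 2 := by positivity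
    nlinarith
  have habs : r * |q| ≤ 1 - (|c| + 1) * l := by
    rw [← abs_of_pos hr0, ← abs_mul]
    exact abs_le_of_sq_le_sq hsq (by linarith)
  rw [inv_mul_eq_div, le_div_iff₀ hα]
  nlinarith [mul_le_mul_of_nonneg_right hr.1.le (abs_nonneg q)]

theorem stmt_4 (a : ℝ) (ha : 0 < a) :
    ¬ ∃ g : ℝ → ℝ,
      ContDiffOn ℝ 2 g (Ioo (Real.exp (-a)) 1) ∧
      (∀ r ∈ Ioo (Real.exp (-a)) 1, g r ∈ Ioo (0:ℝ) 1) ∧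
      (∀ r ∈ Ioo (Real.exp (-a)) 1,
        deriv (deriv g) r + deriv g r / r - g r / r ^ 2 -
          (1 + Real.log (g r)) / (g r * Real.log (g r)) *
            ((deriv g r) ^ 2 - (g r) ^ 2 / r ^ 2) = 0) ∧
      (((∀ r ∈ Ioo (Real.exp (-a)) 1, 0 < deriv g r) ∧
          Tendsto g (𝓝[>] (Real.exp (-a))) (𝓝 0) ∧
          Tendsto g (𝓝[<] (1:ℝ)) (𝓝 1)) ∨
        ((∀ r ∈ Ioo (Real.exp (-a)) 1, deriv g r < 0) ∧
          Tendsto g (𝓝[>] (Real.exp (-a))) (𝓝 1) ∧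
          Tendsto g (𝓝[<] (1:ℝ)) (𝓝 0))) := by
  rintro ⟨g, hC, hg, ode, h⟩
  have hlt : Real.exp (-a) < 1 := by simpa using ha
  obtain ⟨δ, hδ, hle⟩ := exists_pos_le_of_harmonic_profile (Real.exp_pos _) hlt hC hg ode
  rcases h with ⟨-, h, -⟩ | ⟨-, -, h⟩
  · exact hδ.not_ge (ge_of_tendsto h (mem_of_superset (Ioo_mem_nhdsGT hlt) hle))
  · exact hδ.not_ge (ge_of_tendsto h (mem_of_superset (Ioo_mem_nhdsLT hlt) hle))
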